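/- The explicit Latin square X of order 8 given in the context contains exactly 21 intercalates (Latin trades of size 4). -/

import Mathlib

/-- A Latin square of order `n`, represented as a function giving the entry in
row `i`, column `j`: every element occurs exactly once in each row and column. -/
def IsLatinSquare {n : ℕ} (L : Fin n → Fin n → Fin n) : Prop :=
  (∀ i, Function.Injective (L i)) ∧ (∀ j, Function.Injective fun i => L i j)

/-- The set of triples `(i, j; L i j)` of a square `L`. -/
def entries {n : ℕ} (L : Fin n → Fin n → Fin n) : Finset (Fin n × Fin n × Fin n) :=
  Finset.univ.image fun p : Fin n × Fin n => (p.1, p.2, L p.1 p.2)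

/-- `T` is a Latin trade in `L`: the (nonempty) set of entries of `L` in the positions
where `L` differs from some other Latin square `L'` of the same order. -/
def IsTrade {n : ℕ} (L : Fin n → Fin n → Fin n)
    (T : Finset (Fin n × Fin n × Fin n)) : Prop :=
  ∃ L' : Fin n → Fin n → Fin n, IsLatinSquare L' ∧ L' ≠ L ∧
    T = (Finset.univ.filter fun p : Fin n × Fin n => L p.1 p.2 ≠ L' p.1 p.2).image
          fun p => (p.1, p.2, L p.1 p.2)

/-- `U` is a uniquely completable set for `L`: `U ⊆ L` and `L` is the only
Latin square of order `n` containing `U`. -/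
def IsUC {n : ℕ} (L : Fin n → Fin n → Fin n)
    (U : Finset (Fin n × Fin n × Fin n)) : Prop :=
  U ⊆ entries L ∧
    ∀ L' : Fin n → Fin n → Fin n, IsLatinSquare L' → U ⊆ entries L' → L' = L

/-- `C` is a critical set of `L`: a uniquely completable set for `L`,
no proper subset of which is uniquely completable. -/
def IsCritical {n : ℕ} (L : Fin n → Fin n → Fin n)
    (C : Finset (Fin n × Fin n × Fin n)) : Prop :=
  IsUC L C ∧ ∀ C' ⊂ C, ¬ IsUC L C'

/-- `scs n`: the smallest size of a critical set in any Latin square of order `n`. -/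
noncomputable def scs (n : ℕ) : ℕ :=
  sInf {s | ∃ (L : Fin n → Fin n → Fin n) (C : Finset (Fin n × Fin n × Fin n)),
    IsLatinSquare L ∧ IsCritical L C ∧ C.card = s}

/-- `R(T)`: the number of distinct rows occurring in `T`. -/
def rowCount {n : ℕ} (T : Finset (Fin n × Fin n × Fin n)) : ℕ :=
  (T.image fun t => t.1).card

/-- `C(T)`: the number of distinct columns occurring in `T`. -/
def colCount {n : ℕ} (T : Finset (Fin n × Fin n × Fin n)) : ℕ :=
  (T.image fun t => t.2.1).card

/-- `E(T)`: the number of distinct elements occurring in `T`. -/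
def elemCount {n : ℕ} (T : Finset (Fin n × Fin n × Fin n)) : ℕ :=
  (T.image fun t => t.2.2).card

/-- The Latin square `X` (0-based encoding of the square with rows
(1,6,3,4,5,2,8,7), (5,7,1,2,3,8,6,4), (4,5,2,8,6,7,3,1), (3,2,8,7,1,6,4,5),
(2,8,4,6,7,1,5,3), (7,4,6,3,8,5,1,2), (8,1,7,5,4,3,2,6), (6,3,5,1,2,4,7,8)). -/
def X : Fin 8 → Fin 8 → Fin 8 :=
  ![![0, 5, 2, 3, 4, 1, 7, 6],
    ![4, 6, 0, 1, 2, 7, 5, 3],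
    ![3, 4, 1, 7, 5, 6, 2, 0],
    ![2, 1, 7, 6, 0, 5, 3, 4],
    ![1, 7, 3, 5, 6, 0, 4, 2],
    ![6, 3, 5, 2, 7, 4, 0, 1],
    ![7, 0, 6, 4, 3, 2, 1, 5],
    ![5, 2, 4, 0, 1, 3, 6, 7]]

/-- The entries of `L` in the cells where the rows `i`, `i'` meet the columns `j`, `j'`. -/
def subsquare {n : ℕ} (L : Fin n → Fin n → Fin n) (i i' j j' : Fin n) :
    Finset (Fin n × Fin n × Fin n) :=
  (({i, i'} : Finset (Fin n)) ×ˢ ({j, j'} : Finset (Fin n))).image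
    fun p => (p.1, p.2, L p.1 p.2)

/-- Interchanging the two symbols of a `2 × 2` subsquare yields a Latin trade. -/
theorem isTrade_subsquare {n : ℕ} {L : Fin n → Fin n → Fin n} (hL : IsLatinSquare L)
    {i i' j j' : Fin n} (hj : j ≠ j') (h₁ : L i j = L i' j') (h₂ : L i j' = L i' j) :
    IsTrade L (subsquare L i i' j j') := by
  obtain ⟨hrow, hcol⟩ := hL
  have hr : ∀ x y z, L x y = L x z → y = z := fun x y z h => hrow x h
  have hc : ∀ x y z, L y x = L z x → y = z := fun x y z h => hcol x h
  refine ⟨fun x y => if x = i ∨ x = i' then L x (Equiv.swap j j' y) else L x y,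
    ⟨fun x y z h => ?_, fun y x z h => ?_⟩, fun h => ?_, ?_⟩
  · by_cases hx : x = i ∨ x = i'
    · simp only [hx, if_true] at h
      exact (Equiv.swap j j').injective (hr _ _ _ h)
    · simp only [hx, if_false] at h
      exact hr _ _ _ h
  · simp only [Equiv.swap_apply_def] at h
    grind
  · have := congrFun (congrFun h i) j
    simp only [true_or, if_true, Equiv.swap_apply_left] at this
    exact hj (hr _ _ _ this).symm
  · unfold subsquare
    congr 1
    ext ⟨x, y⟩
    simp only [Finset.mem_product, Finset.mem_insert, Finset.mem_singleton,
      Equiv.swap_apply_def]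
    grind

/-- Every Latin trade of size 4 consists of the entries of a `2 × 2` subsquare. -/
theorem IsTrade.exists_eq_subsquare {n : ℕ} {L : Fin n → Fin n → Fin n} (hL : IsLatinSquare L)
    {T : Finset (Fin n × Fin n × Fin n)} (hT : IsTrade L T) (hcard : T.card = 4) :
    ∃ i i' j j', i ≠ i' ∧ j ≠ j' ∧ L i j = L i' j' ∧ L i j' = L i' j ∧
      T = subsquare L i i' j j' := by
  obtain ⟨L', ⟨hrow', hcol'⟩, -, rfl⟩ := hT
  obtain ⟨hrow, hcol⟩ := hL
  rw [Finset.card_image_of_injective _ (by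
    rintro ⟨a, b⟩ ⟨c, d⟩ h; simp only [Prod.mk.injEq] at h ⊢; tauto)] at hcard
  set D := Finset.univ.filter fun p : Fin n × Fin n => L p.1 p.2 ≠ L' p.1 p.2 with hD
  have hmem : ∀ x y, (x, y) ∈ D ↔ L x y ≠ L' x y := by simp [hD]
  -- an entry displaced from a cell reappears elsewhere in the same row and in the same column
  have hr : ∀ x y, (x, y) ∈ D → ∃ z, z ≠ y ∧ (x, z) ∈ D ∧ L' x z = L x y := by
    intro x y h
    obtain ⟨z, hz⟩ := Finite.surjective_of_injective (hrow' x) (L x y)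
    have hzy : z ≠ y := by rintro rfl; exact (hmem _ _).1 h hz.symm
    exact ⟨z, hzy, (hmem _ _).2 fun e => hzy (hrow x (e.trans hz)), hz⟩
  have hc : ∀ x y, (x, y) ∈ D → ∃ z, z ≠ x ∧ (z, y) ∈ D ∧ L' z y = L x y := by
    intro x y h
    obtain ⟨z, hz⟩ := Finite.surjective_of_injective (hcol' y) (L x y)
    have hzx : z ≠ x := by rintro rfl; exact (hmem _ _).1 h hz.symm
    exact ⟨z, hzx, (hmem _ _).2 fun e => hzx (hcol y (e.trans hz)), hz⟩
  obtain ⟨⟨i, j⟩, hij⟩ := Finset.card_pos.1 (by omega : 0 < D.card)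
  obtain ⟨j', hj, hij', e₁⟩ := hr i j hij
  obtain ⟨i', hi, hi'j, e₂⟩ := hc i j hij
  obtain ⟨k, hk, hkj', e₃⟩ := hc i j' hij'
  obtain ⟨l, hl, hi'l, e₄⟩ := hr i' j hi'j
  have hDeq : ({(i, j), (i, j'), (i', j), (k, j')} : Finset (Fin n × Fin n)) = D := by
    refine Finset.eq_of_subset_of_card_le ?_ ?_
    · simp [Finset.insert_subset_iff, hij, hij', hi'j, hkj']
    · rw [hcard, Finset.card_insert_of_notMem, Finset.card_insert_of_notMem,
        Finset.card_pair] <;> simp [hi.symm, hj, hj.symm, hk.symm]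
  have hD' : ∀ x y, (x, y) ∈ D ↔
      (x = i ∧ y = j) ∨ (x = i ∧ y = j') ∨ (x = i' ∧ y = j) ∨ (x = k ∧ y = j') := by
    intro x y
    simp [← hDeq]
  obtain ⟨rfl, rfl⟩ : i' = k ∧ l = j' := by
    have := (hD' _ _).1 hi'l
    tauto
  obtain ⟨m, hm, him, e₅⟩ := hr i' l hi'l
  obtain rfl : m = j := by
    have := (hD' _ _).1 him
    tauto
  refine ⟨i, i', m, l, hi.symm, hj.symm, e₂.symm.trans e₅, e₃.symm.trans e₄, ?_⟩
  unfold subsquare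
  congr 1
  ext ⟨x, y⟩
  rw [hD']
  simp only [Finset.mem_product, Finset.mem_insert, Finset.mem_singleton]
  tauto

theorem card_subsquare {n : ℕ} (L : Fin n → Fin n → Fin n) {i i' j j' : Fin n}
    (hi : i ≠ i') (hj : j ≠ j') : (subsquare L i i' j j').card = 4 := by
  unfold subsquare
  rw [Finset.card_image_of_injective _ (by
    rintro ⟨a, b⟩ ⟨c, d⟩ h; simp only [Prod.mk.injEq] at h ⊢; tauto),
    Finset.card_product, Finset.card_pair hi, Finset.card_pair hj]

theorem subsquare_swap_rows {n : ℕ} (L : Fin n → Fin n → Fin n) (i i' j j' : Fin n) :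
    subsquare L i i' j j' = subsquare L i' i j j' := by
  rw [subsquare, Finset.pair_comm i i', subsquare]

theorem subsquare_swap_cols {n : ℕ} (L : Fin n → Fin n → Fin n) (i i' j j' : Fin n) :
    subsquare L i i' j j' = subsquare L i i' j' j := by
  rw [subsquare, Finset.pair_comm j j', subsquare]

/-- The `2 × 2` subsquares of `L`, each recorded once as its rows `i < i'` and columns `j < j'`. -/
def subsquareIndices {n : ℕ} (L : Fin n → Fin n → Fin n) :
    Finset ((Fin n × Fin n) × Fin n × Fin n) :=
  Finset.univ.filter fun q => q.1.1 < q.1.2 ∧ q.2.1 < q.2.2 ∧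
    L q.1.1 q.2.1 = L q.1.2 q.2.2 ∧ L q.1.1 q.2.2 = L q.1.2 q.2.1

/-- The Latin trades of size 4 are exactly the `2 × 2` subsquares. -/
theorem isTrade_and_card_eq_four_iff {n : ℕ} {L : Fin n → Fin n → Fin n}
    (hL : IsLatinSquare L) (T : Finset (Fin n × Fin n × Fin n)) :
    IsTrade L T ∧ T.card = 4 ↔
      T ∈ (subsquareIndices L).image fun q => subsquare L q.1.1 q.1.2 q.2.1 q.2.2 := by
  simp only [Finset.mem_image, subsquareIndices, Finset.mem_filter, Finset.mem_univ, true_and,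
    Prod.exists]
  constructor
  · rintro ⟨hT, hcard⟩
    obtain ⟨i, i', j, j', hi, hj, h₁, h₂, rfl⟩ := hT.exists_eq_subsquare hL hcard
    rcases hi.lt_or_gt with hi | hi <;> rcases hj.lt_or_gt with hj | hj
    · exact ⟨i, i', j, j', ⟨hi, hj, h₁, h₂⟩, rfl⟩
    · exact ⟨i, i', j', j, ⟨hi, hj, h₂, h₁⟩, subsquare_swap_cols ..⟩
    · exact ⟨i', i, j, j', ⟨hi, hj, h₂.symm, h₁.symm⟩, subsquare_swap_rows ..⟩
    · exact ⟨i', i, j', j, ⟨hi, hj, h₁.symm, h₂.symm⟩,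
        (subsquare_swap_rows ..).trans (subsquare_swap_cols ..)⟩
  · rintro ⟨i, i', j, j', ⟨hi, hj, h₁, h₂⟩, rfl⟩
    exact ⟨isTrade_subsquare hL hj.ne h₁ h₂, card_subsquare L hi.ne hj.ne⟩

theorem isLatinSquare_X : IsLatinSquare X := by
  unfold IsLatinSquare Function.Injective
  decide +kernel

/-- The Latin square `X` contains exactly 21 intercalates (Latin trades of size 4). -/
theorem X_intercalates :
    Nat.card {T : Finset (Fin 8 × Fin 8 × Fin 8) // IsTrade X T ∧ T.card = 4} = 21 := by
  rw [Nat.card_congr (Equiv.subtypeEquivRight (isTrade_and_card_eq_four_iff isLatinSquare_X)),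
    Nat.card_eq_fintype_card, Fintype.card_coe]
  decide +kernel
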